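/- arXiv:1111.6514 — 2 statements merged into one kernel-verified Lean document; each statement's English description precedes it below -/
import Mathlib

section
/- Let v ∈ ℝ^n and a ∈ ℝ with |a| < |v|, and let n ≥ 2 be even. Then the real part of the limit as ε→0+ of ∫_{S^{n−1}} dω/(⟨ω,v⟩ − a − iε)^n equals zero. -/
open MeasureTheory Filter
open scoped RealInnerProductSpace

section
variable {E : Type*} [NormedAddCommGroup E] [InnerProductSpace ℝ E] [FiniteDimensional ℝ E]

theorem exists_rot (e w : E) (he : ‖e‖ = 1) (hw : ‖w‖ = 1) (hew : ⟪e, w⟫ = 0) (θ : ℝ) :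
    ∃ R : E ≃ₗᵢ[ℝ] E, ∀ x, ⟪e, R x⟫ = Real.cos θ * ⟪e, x⟫ - Real.sin θ * ⟪w, x⟫ ∧
      ⟪w, R x⟫ = Real.sin θ * ⟪e, x⟫ + Real.cos θ * ⟪w, x⟫ := by
  have hee : ⟪e, e⟫ = 1 := by rw [real_inner_self_eq_norm_sq, he]; norm_num
  have hww : ⟪w, w⟫ = 1 := by rw [real_inner_self_eq_norm_sq, hw]; norm_num
  have hwe : ⟪w, e⟫ = 0 := by rw [real_inner_comm, hew]
  let L : E →ₗ[ℝ] E :=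
    { toFun := fun x => x + ((Real.cos θ - 1) * ⟪e, x⟫ - Real.sin θ * ⟪w, x⟫) • e
        + (Real.sin θ * ⟪e, x⟫ + (Real.cos θ - 1) * ⟪w, x⟫) • w
      map_add' := by intro x y; simp only [inner_add_right]; module
      map_smul' := by intro c x; simp only [inner_smul_right, RingHom.id_apply]; module }
  have hL : ∀ x, L x = x + ((Real.cos θ - 1) * ⟪e, x⟫ - Real.sin θ * ⟪w, x⟫) • e
        + (Real.sin θ * ⟪e, x⟫ + (Real.cos θ - 1) * ⟪w, x⟫) • w := fun x => rfl
  have h1 : ∀ x, ⟪e, L x⟫ = Real.cos θ * ⟪e, x⟫ - Real.sin θ * ⟪w, x⟫ := by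
    intro x; rw [hL]; simp only [inner_add_right, inner_smul_right, hee, hew]; ring
  have h2 : ∀ x, ⟪w, L x⟫ = Real.sin θ * ⟪e, x⟫ + Real.cos θ * ⟪w, x⟫ := by
    intro x; rw [hL]; simp only [inner_add_right, inner_smul_right, hww, hwe]; ring
  have hn : ∀ x, ‖L x‖ = ‖x‖ := by
    intro x
    rw [← sq_eq_sq₀ (norm_nonneg _) (norm_nonneg _), ← real_inner_self_eq_norm_sq,
      ← real_inner_self_eq_norm_sq]
    rw [hL]
    simp only [inner_add_right, inner_add_left, inner_smul_right, inner_smul_left, hww, hwe, hee, hew,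
      real_inner_comm e x, real_inner_comm w x]
    simp only [RCLike.conj_to_real]
    have := Real.sin_sq_add_cos_sq θ
    generalize ⟪e, x⟫ = c
    generalize ⟪w, x⟫ = s
    rw [← sub_eq_zero]
    linear_combination (c^2 + s^2) * this
  let R : E →ₗᵢ[ℝ] E := ⟨L, hn⟩
  exact ⟨R.toLinearIsometryEquiv rfl, fun x => ⟨h1 x, h2 x⟩⟩

variable [MeasurableSpace E] [BorelSpace E]

theorem rot_identity (μ : Measure E) [IsFiniteMeasure μ] (hs : ∀ᵐ x ∂μ, ‖x‖ = 1)
    (hinv : ∀ R : E ≃ₗᵢ[ℝ] E, MeasurePreserving R μ μ)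
    (e w : E) (he : ‖e‖ = 1) (hw : ‖w‖ = 1) (hew : ⟪e, w⟫ = 0)
    (f f' : ℝ → ℂ) (hf : ∀ x, HasDerivAt f (f' x) x) (hf' : Continuous f') :
    Integrable (fun x => f' ⟪e, x⟫ * (⟪w, x⟫ : ℂ) ^ 2 - f ⟪e, x⟫ * (⟪e, x⟫ : ℂ)) μ ∧
    ∫ x, (f' ⟪e, x⟫ * (⟪w, x⟫ : ℂ) ^ 2 - f ⟪e, x⟫ * (⟪e, x⟫ : ℂ)) ∂μ = 0 := by
  have hfc : Continuous f := continuous_iff_continuousAt.2 fun x => (hf x).continuousAt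
  obtain ⟨M, hM⟩ := (isCompact_Icc (a := (-2:ℝ)) (b := 2)).exists_bound_of_continuousOn hfc.continuousOn
  obtain ⟨M', hM'⟩ := (isCompact_Icc (a := (-2:ℝ)) (b := 2)).exists_bound_of_continuousOn hf'.continuousOn
  let A : ℝ → E → ℝ := fun θ x => Real.cos θ * ⟪e, x⟫ - Real.sin θ * ⟪w, x⟫
  let B : ℝ → E → ℝ := fun θ x => Real.sin θ * ⟪e, x⟫ + Real.cos θ * ⟪w, x⟫
  have hAc : ∀ θ, Continuous (A θ) := fun θ => by fun_prop
  have hBc : ∀ θ, Continuous (B θ) := fun θ => by fun_prop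
  have hAd : ∀ x θ, HasDerivAt (fun θ => A θ x) (- B θ x) θ := fun x θ => by
    have := ((Real.hasDerivAt_cos θ).mul_const ⟪e, x⟫).sub ((Real.hasDerivAt_sin θ).mul_const ⟪w, x⟫)
    exact this.congr_deriv (by change _ = -(Real.sin θ * ⟪e, x⟫ + Real.cos θ * ⟪w, x⟫); ring)
  have hBd : ∀ x θ, HasDerivAt (fun θ => B θ x) (A θ x) θ := fun x θ => by
    have := ((Real.hasDerivAt_sin θ).mul_const ⟪e, x⟫).add ((Real.hasDerivAt_cos θ).mul_const ⟪w, x⟫)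
    exact this.congr_deriv (by change _ = Real.cos θ * ⟪e, x⟫ - Real.sin θ * ⟪w, x⟫; ring)
  have hbd : ∀ x, ‖x‖ = 1 → ∀ θ, |A θ x| ≤ 2 ∧ |B θ x| ≤ 2 := by
    intro x hx θ
    have h1 : |⟪e, x⟫| ≤ 1 := by
      have := abs_real_inner_le_norm e x; rwa [he, hx, one_mul] at this
    have h2 : |⟪w, x⟫| ≤ 1 := by
      have := abs_real_inner_le_norm w x; rwa [hw, hx, one_mul] at this
    have h3 := Real.abs_cos_le_one θ
    have h4 := Real.abs_sin_le_one θ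
    constructor
    · refine (abs_sub _ _).trans ?_
      rw [abs_mul, abs_mul]
      have := mul_le_one₀ h3 (abs_nonneg _) h1
      have := mul_le_one₀ h4 (abs_nonneg _) h2
      linarith
    · refine (abs_add_le _ _).trans ?_
      rw [abs_mul, abs_mul]
      have := mul_le_one₀ h4 (abs_nonneg _) h1
      have := mul_le_one₀ h3 (abs_nonneg _) h2
      linarith
  let F : ℝ → E → ℂ := fun θ x => f (A θ x) * (B θ x : ℂ)
  let F' : ℝ → E → ℂ := fun θ x => f' (A θ x) * (-(B θ x : ℂ)) * (B θ x : ℂ) + f (A θ x) * (A θ x : ℂ)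
  have hFc : ∀ θ, Continuous (F θ) := fun θ =>
    (hfc.comp (hAc θ)).mul (Complex.continuous_ofReal.comp (hBc θ))
  have hFc' : ∀ θ, Continuous (F' θ) := fun θ =>
    (((hf'.comp (hAc θ)).mul (Complex.continuous_ofReal.comp (hBc θ)).neg).mul
      (Complex.continuous_ofReal.comp (hBc θ))).add
      ((hfc.comp (hAc θ)).mul (Complex.continuous_ofReal.comp (hAc θ)))
  have hFd : ∀ x θ, HasDerivAt (fun θ => F θ x) (F' θ x) θ := by
    intro x θ
    have h1 := (hf (A θ x)).scomp θ (hAd x θ)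
    have h2 := (hBd x θ).ofReal_comp
    refine (h1.mul h2).congr_deriv ?_
    change _ = f' (A θ x) * (-(B θ x : ℂ)) * (B θ x : ℂ) + f (A θ x) * (A θ x : ℂ)
    rw [Complex.real_smul]; push_cast; simp only [Function.comp]; ring
  have hJ : ∀ θ, ∫ x, F θ x ∂μ = ∫ x, F 0 x ∂μ := by
    intro θ
    obtain ⟨R, hR⟩ := exists_rot e w he hw hew θ
    have := (hinv R).integral_comp R.toHomeomorph.measurableEmbedding (F 0)
    rw [← this]
    congr 1; ext x
    simp [F, A, B, (hR x).1, (hR x).2]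
  have hM0 : 0 ≤ M := (norm_nonneg _).trans (hM 0 (by norm_num))
  have hM0' : 0 ≤ M' := (norm_nonneg _).trans (hM' 0 (by norm_num))
  have key := hasDerivAt_integral_of_dominated_loc_of_deriv_le (μ := μ) (F := F) (F' := F') (x₀ := (0:ℝ))
    (s := Set.univ) (bound := fun _ => M' * 2 * 2 + M * 2) Filter.univ_mem
    (Filter.Eventually.of_forall fun θ => (hFc θ).aestronglyMeasurable)
    (Integrable.of_bound (hFc 0).aestronglyMeasurable (M * 2) (by
      filter_upwards [hs] with x hx
      obtain ⟨h1, h2⟩ := hbd x hx 0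
      rw [norm_mul, Complex.norm_real]
      exact mul_le_mul (hM _ (abs_le.1 h1)) h2 (norm_nonneg _) hM0))
    (hFc' 0).aestronglyMeasurable (by
      filter_upwards [hs] with x hx θ _
      obtain ⟨h1, h2⟩ := hbd x hx θ
      refine (norm_add_le _ _).trans ?_
      rw [norm_mul, norm_mul, norm_mul, norm_neg, Complex.norm_real, Complex.norm_real]
      have h3 := hM _ (abs_le.1 h1)
      have h4 := hM' _ (abs_le.1 h1)
      rw [Real.norm_eq_abs, Real.norm_eq_abs]
      gcongr) (integrable_const _)
    (Filter.Eventually.of_forall fun x θ _ => hFd x θ)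
  have h0 : ∀ x, F' 0 x = -(f' ⟪e, x⟫ * (⟪w, x⟫ : ℂ) ^ 2 - f ⟪e, x⟫ * (⟪e, x⟫ : ℂ)) := by
    intro x; simp [F', A, B]; ring
  have h00 : F' 0 = fun x => -(f' ⟪e, x⟫ * (⟪w, x⟫ : ℂ) ^ 2 - f ⟪e, x⟫ * (⟪e, x⟫ : ℂ)) := funext h0
  rw [h00] at key
  refine ⟨key.1.neg.congr (ae_of_all _ fun x => neg_neg _), ?_⟩
  have h3 := key.2
  rw [show (fun θ => ∫ x, F θ x ∂μ) = fun _ => ∫ x, F 0 x ∂μ from funext hJ] at h3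
  have := h3.unique (hasDerivAt_const _ _)
  rw [integral_neg] at this
  exact neg_eq_zero.1 this

theorem div_identity (n : ℕ) (b : OrthonormalBasis (Fin n) ℝ E) (i : Fin n)
    (μ : Measure E) [IsFiniteMeasure μ] (hs : ∀ᵐ x ∂μ, ‖x‖ = 1)
    (hinv : ∀ R : E ≃ₗᵢ[ℝ] E, MeasurePreserving R μ μ)
    (f f' : ℝ → ℂ) (hf : ∀ x, HasDerivAt f (f' x) x) (hf' : Continuous f') :
    ∫ x, (f' ⟪b i, x⟫ * (1 - (⟪b i, x⟫ : ℂ) ^ 2) - ((n : ℂ) - 1) * (f ⟪b i, x⟫ * (⟪b i, x⟫ : ℂ))) ∂μ = 0 := by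
  have h := fun j (hj : j ∈ Finset.univ.erase i) => rot_identity μ hs hinv (b i) (b j) (b.norm_eq_one i)
    (b.norm_eq_one j) (b.inner_eq_zero (Finset.ne_of_mem_erase hj).symm) f f' hf hf'
  have h2 := integral_finsetSum (Finset.univ.erase i) (fun j hj => (h j hj).1)
  rw [Finset.sum_eq_zero (fun j hj => (h j hj).2)] at h2
  rw [← h2]
  apply integral_congr_ae
  filter_upwards [hs] with x hx
  have h3 := b.sum_sq_norm_inner_right x
  rw [hx, ← Finset.add_sum_erase _ _ (Finset.mem_univ i)] at h3
  simp only [Real.norm_eq_abs, sq_abs] at h3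
  have h4 : ∑ j ∈ Finset.univ.erase i, (⟪b j, x⟫ : ℂ) ^ 2 = 1 - (⟪b i, x⟫ : ℂ) ^ 2 := by
    rw [eq_sub_iff_add_eq']; rw [one_pow] at h3; exact_mod_cast h3
  rw [Finset.sum_sub_distrib, ← Finset.mul_sum, h4, Finset.sum_const, Finset.card_erase_of_mem (Finset.mem_univ i)]
  have : 1 ≤ n := i.pos
  simp [Nat.cast_sub this]

theorem sub_norm_bound (X : ℝ) (z : ℂ) : z.im ≤ ‖(X : ℂ) - z‖ := by
  have := Complex.abs_im_le_norm ((X : ℂ) - z)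
  simp at this
  exact (le_abs_self _).trans this

theorem sub_ne (X : ℝ) (z : ℂ) (hz : 0 < z.im) : (X : ℂ) - z ≠ 0 :=
  norm_pos_iff.1 (hz.trans_le (sub_norm_bound X z))

theorem inv_pow_bound (X : ℝ) (z : ℂ) (m : ℕ) (δ : ℝ) (hδ : 0 < δ) (hz : δ ≤ z.im) :
    ‖(((X : ℂ) - z) ^ m)⁻¹‖ ≤ (δ ^ m)⁻¹ := by
  rw [norm_inv, norm_pow]
  have := hz.trans (sub_norm_bound X z)
  gcongr

theorem kernel_cont (v : E) (z : ℂ) (hz : 0 < z.im) (m : ℕ) :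
    Continuous (fun x : E => (((⟪x, v⟫ : ℂ) - z) ^ m)⁻¹) := by
  refine Continuous.inv₀ ?_ (fun x => pow_ne_zero _ (sub_ne _ _ hz))
  fun_prop

theorem kernel_int (μ : Measure E) [IsFiniteMeasure μ] (v : E) (z : ℂ) (hz : 0 < z.im) (m : ℕ) :
    Integrable (fun x : E => (((⟪x, v⟫ : ℂ) - z) ^ m)⁻¹) μ :=
  Integrable.of_bound (kernel_cont v z hz m).aestronglyMeasurable _
    (ae_of_all _ fun x => inv_pow_bound _ z m z.im hz le_rfl)

theorem inv_pow_deriv (X z : ℂ) (k : ℕ) (h : X - z ≠ 0) :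
    HasDerivAt (fun z : ℂ => ((X - z) ^ (k + 1))⁻¹) ((k + 1 : ℂ) * ((X - z) ^ (k + 2))⁻¹) z := by
  have := (((hasDerivAt_id z).const_sub X).pow (k + 1)).inv (pow_ne_zero _ h)
  refine this.congr_deriv ?_
  simp only [id, Pi.pow_apply]
  push_cast
  try simp only [Nat.add_sub_cancel]
  field_simp
  ring

theorem inv_pow_deriv' (r : ℂ) (t : ℝ) (z : ℂ) (k : ℕ) (h : r * t - z ≠ 0) :
    HasDerivAt (fun t : ℝ => ((r * t - z) ^ (k + 1))⁻¹)
      (-(k + 1 : ℂ) * r * ((r * t - z) ^ (k + 2))⁻¹) t := by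
  have h0 : HasDerivAt (fun t : ℝ => r * (t : ℂ) - z) r t := by
    have := ((hasDerivAt_id t).ofReal_comp.const_mul r).sub_const z
    simpa using this
  have := (h0.pow (k + 1)).inv (pow_ne_zero _ h)
  refine this.congr_deriv ?_
  simp only [Pi.pow_apply]
  push_cast
  try simp only [Nat.add_sub_cancel]
  field_simp
  ring

theorem I_deriv (μ : Measure E) [IsFiniteMeasure μ] (v : E) (z : ℂ) (hz : 0 < z.im) (k : ℕ) :
    HasDerivAt (fun z : ℂ => ∫ x, (((⟪x, v⟫ : ℂ) - z) ^ (k + 1))⁻¹ ∂μ)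
      ((k + 1 : ℂ) * ∫ x, (((⟪x, v⟫ : ℂ) - z) ^ (k + 2))⁻¹ ∂μ) z := by
  rw [← integral_const_mul]
  have hopen : IsOpen {y : ℂ | z.im / 2 < y.im} := isOpen_lt continuous_const Complex.continuous_im
  have hmem : {y : ℂ | z.im / 2 < y.im} ∈ nhds z := hopen.mem_nhds (by simpa using hz)
  refine (hasDerivAt_integral_of_dominated_loc_of_deriv_le
    (F := fun z x => (((⟪x, v⟫ : ℂ) - z) ^ (k + 1))⁻¹)
    (F' := fun z x => (k + 1 : ℂ) * (((⟪x, v⟫ : ℂ) - z) ^ (k + 2))⁻¹)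
    (bound := fun _ => ‖(k + 1 : ℂ)‖ * ((z.im / 2) ^ (k + 2))⁻¹) hmem ?_ (kernel_int μ v z hz _) ?_ ?_
    (integrable_const _) ?_).2
  · filter_upwards [hmem] with y hy
    have hy : z.im / 2 < y.im := hy
    exact (kernel_cont v y (by linarith) _).aestronglyMeasurable
  · exact ((kernel_cont v z hz _).const_mul _).aestronglyMeasurable
  · refine ae_of_all _ fun x y hy => ?_
    have hy : z.im / 2 < y.im := hy
    rw [norm_mul]
    gcongr
    exact inv_pow_bound _ _ _ _ (by linarith) hy.le
  · refine ae_of_all _ fun x y hy => ?_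
    have hy : z.im / 2 < y.im := hy
    exact inv_pow_deriv _ _ _ (sub_ne _ _ (by linarith))

theorem I_rel (k : ℕ) (b : OrthonormalBasis (Fin (k + 2)) ℝ E) (i : Fin (k + 2))
    (μ : Measure E) [IsFiniteMeasure μ] (hs : ∀ᵐ x ∂μ, ‖x‖ = 1)
    (hinv : ∀ R : E ≃ₗᵢ[ℝ] E, MeasurePreserving R μ μ) (v : E) (r : ℝ)
    (hv : v = r • b i) (z : ℂ) (hz : 0 < z.im) :
    ((r : ℂ) ^ 2 - z ^ 2) * ∫ x, (((⟪x, v⟫ : ℂ) - z) ^ (k + 2))⁻¹ ∂μ =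
      z * ∫ x, (((⟪x, v⟫ : ℂ) - z) ^ (k + 1))⁻¹ ∂μ := by
  have hne : ∀ t : ℝ, (r : ℂ) * t - z ≠ 0 := fun t => by
    have := sub_ne (r * t) z hz; push_cast at this; exact this
  have h := div_identity (k + 2) b i μ hs hinv (fun t => (((r : ℂ) * t - z) ^ (k + 1))⁻¹)
    (fun t => -(k + 1 : ℂ) * r * (((r : ℂ) * t - z) ^ (k + 2))⁻¹)
    (fun t => inv_pow_deriv' r t z k (hne t)) (by
      refine continuous_const.mul (Continuous.inv₀ (by fun_prop) fun t => pow_ne_zero _ (hne t)))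
  rw [← sub_eq_zero, ← integral_const_mul, ← integral_const_mul,
    ← integral_sub ((kernel_int μ v z hz _).const_mul _) ((kernel_int μ v z hz _).const_mul _)]
  have hk : (k + 1 : ℂ) ≠ 0 := by exact_mod_cast Nat.succ_ne_zero k
  have h2 : (-(k + 1 : ℂ)⁻¹ * r) * 0 = (0 : ℂ) := mul_zero _
  rw [← h2, ← h, ← integral_const_mul]
  congr 1; ext x
  have hx : ((⟪x, v⟫ : ℝ) : ℂ) = r * (⟪b i, x⟫ : ℝ) := by
    rw [hv, inner_smul_right, real_inner_comm]; push_cast; rfl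
  rw [hx]
  have := hne ⟪b i, x⟫
  generalize ((⟪b i, x⟫ : ℝ) : ℂ) = t at *
  push_cast
  field_simp
  ring

theorem I_const (k : ℕ) (b : OrthonormalBasis (Fin (k + 2)) ℝ E) (i : Fin (k + 2))
    (μ : Measure E) [IsFiniteMeasure μ] (hs : ∀ᵐ x ∂μ, ‖x‖ = 1)
    (hinv : ∀ R : E ≃ₗᵢ[ℝ] E, MeasurePreserving R μ μ) (v : E) (r : ℝ)
    (hv : v = r • b i) (z : ℂ) (hz : 0 < z.im) :
    (∫ x, (((⟪x, v⟫ : ℂ) - z) ^ (k + 1))⁻¹ ∂μ) ^ 2 * ((r : ℂ) ^ 2 - z ^ 2) ^ (k + 1) =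
    (∫ x, (((⟪x, v⟫ : ℂ) - Complex.I) ^ (k + 1))⁻¹ ∂μ) ^ 2 * ((r : ℂ) ^ 2 + 1) ^ (k + 1) := by
  have hopen : IsOpen {y : ℂ | 0 < y.im} := isOpen_lt continuous_const Complex.continuous_im
  have hconv : Convex ℝ {y : ℂ | 0 < y.im} := convex_halfSpace_im_gt 0
  have hd : ∀ y : ℂ, 0 < y.im → HasDerivAt (fun z : ℂ =>
      (∫ x, (((⟪x, v⟫ : ℂ) - z) ^ (k + 1))⁻¹ ∂μ) ^ 2 * ((r : ℂ) ^ 2 - z ^ 2) ^ (k + 1)) 0 y := by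
    intro y hy
    have h1 := (I_deriv μ v y hy k).pow 2
    have h2 := (((hasDerivAt_id y).pow 2).const_sub ((r : ℂ) ^ 2)).pow (k + 1)
    refine (h1.mul h2).congr_deriv ?_
    have h3 := I_rel k b i μ hs hinv v r hv y hy
    simp only [Pi.pow_apply, id]
    push_cast
    rw [pow_succ ((r : ℂ) ^ 2 - y ^ 2) k]
    generalize (∫ x, (((⟪x, v⟫ : ℂ) - y) ^ (k + 1))⁻¹ ∂μ) = G at *
    generalize (∫ x, (((⟪x, v⟫ : ℂ) - y) ^ (k + 2))⁻¹ ∂μ) = H at *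
    linear_combination 2 * G * (k + 1 : ℂ) * ((r : ℂ) ^ 2 - y ^ 2) ^ k * h3
  have := hopen.is_const_of_deriv_eq_zero hconv.isPreconnected
    (fun y hy => (hd y hy).differentiableAt.differentiableWithinAt)
    (fun y hy => (hd y hy).deriv) (x := z) (y := Complex.I) hz (by simp)
  simpa using this

theorem I_imag (k : ℕ) (hk : Even k) (μ : Measure E)
    (hinv : ∀ R : E ≃ₗᵢ[ℝ] E, MeasurePreserving R μ μ) (v : E) :
    (∫ x, (((⟪x, v⟫ : ℂ) - Complex.I) ^ (k + 1))⁻¹ ∂μ).re = 0 := by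
  have h1 := (hinv (LinearIsometryEquiv.neg ℝ)).integral_comp
    (LinearIsometryEquiv.neg ℝ).toHomeomorph.measurableEmbedding
    (fun x => (((⟪x, v⟫ : ℂ) - Complex.I) ^ (k + 1))⁻¹)
  have h2 : (starRingEnd ℂ) (∫ x, (((⟪x, v⟫ : ℂ) - Complex.I) ^ (k + 1))⁻¹ ∂μ) =
      - ∫ x, (((⟪x, v⟫ : ℂ) - Complex.I) ^ (k + 1))⁻¹ ∂μ := by
    rw [← integral_conj]
    conv_rhs => rw [← h1]
    rw [← integral_neg]
    congr 1; ext x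
    simp only [LinearIsometryEquiv.coe_neg, inner_neg_left, map_inv₀, map_pow, map_sub,
      Complex.conj_ofReal, Complex.conj_I]
    rw [← inv_neg, ← hk.add_one.neg_pow]
    congr 2
    push_cast; ring
  have := congrArg Complex.re h2
  simp at this
  linarith

theorem re_tendsto (k : ℕ) (hk : Even k) (b : OrthonormalBasis (Fin (k + 2)) ℝ E) (i : Fin (k + 2))
    (μ : Measure E) [IsFiniteMeasure μ] (hs : ∀ᵐ x ∂μ, ‖x‖ = 1)
    (hinv : ∀ R : E ≃ₗᵢ[ℝ] E, MeasurePreserving R μ μ) (v : E) (r : ℝ)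
    (hv : v = r • b i) (a : ℝ) (ha : |a| < r) :
    Tendsto (fun ε : ℝ =>
      (∫ x, (((⟪x, v⟫ : ℂ) - (a + ε * Complex.I)) ^ (k + 2))⁻¹ ∂μ).re)
      (nhdsWithin 0 (Set.Ioi 0)) (nhds 0) := by
  have hra : 0 < r ^ 2 - a ^ 2 := by
    have := sq_lt_sq' (by linarith [neg_abs_le a]) ((le_abs_self a).trans_lt ha)
    linarith
  obtain ⟨c, hc⟩ : ∃ c : ℝ, (∫ x, (((⟪x, v⟫ : ℂ) - Complex.I) ^ (k + 1))⁻¹ ∂μ) = c * Complex.I := by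
    refine ⟨(∫ x, (((⟪x, v⟫ : ℂ) - Complex.I) ^ (k + 1))⁻¹ ∂μ).im, ?_⟩
    apply Complex.ext <;> simp [I_imag k hk μ hinv v]
  let C : ℝ := -(c ^ 2 * (r ^ 2 + 1) ^ (k + 1))
  have hC : C ≤ 0 := by
    have : 0 ≤ c ^ 2 * (r ^ 2 + 1) ^ (k + 1) := by positivity
    simp only [C]; linarith
  let q : ℂ → ℂ := fun z => C * z ^ 2 / ((r : ℂ) ^ 2 - z ^ 2) ^ (k + 3)
  have hq : ∀ z : ℂ, 0 < z.im → (∫ x, (((⟪x, v⟫ : ℂ) - z) ^ (k + 2))⁻¹ ∂μ) ^ 2 = q z := by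
    intro z hz
    have h1 := I_rel k b i μ hs hinv v r hv z hz
    have h2 := I_const k b i μ hs hinv v r hv z hz
    rw [hc] at h2
    have hne : (r : ℂ) ^ 2 - z ^ 2 ≠ 0 := by
      have e1 := sub_ne r z hz
      have e2 := sub_ne (-r) z hz
      have : (r : ℂ) ^ 2 - z ^ 2 = - (((r : ℂ) - z) * (((-r : ℝ) : ℂ) - z)) := by push_cast; ring
      rw [this]
      exact neg_ne_zero.2 (mul_ne_zero e1 e2)
    simp only [q, C]
    rw [eq_div_iff (pow_ne_zero _ hne)]
    push_cast
    generalize (∫ x, (((⟪x, v⟫ : ℂ) - z) ^ (k + 1))⁻¹ ∂μ) = G at *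
    generalize (∫ x, (((⟪x, v⟫ : ℂ) - z) ^ (k + 2))⁻¹ ∂μ) = H at *
    rw [mul_pow, Complex.I_sq] at h2
    generalize (r : ℂ) ^ 2 - z ^ 2 = D at *
    calc H ^ 2 * D ^ (k + 3) = (D * H) ^ 2 * D ^ (k + 1) := by ring
      _ = z ^ 2 * (G ^ 2 * D ^ (k + 1)) := by rw [h1]; ring
      _ = _ := by rw [h2]; ring
  have hre : ∀ w : ℂ, w.re ^ 2 = (‖w ^ 2‖ + (w ^ 2).re) / 2 := by
    intro w
    rw [norm_pow, ← Complex.normSq_eq_norm_sq, Complex.normSq_apply, sq w, Complex.mul_re]; ring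
  have hcont : ContinuousAt (fun ε : ℝ => (‖q (a + ε * Complex.I)‖ + (q (a + ε * Complex.I)).re) / 2) 0 := by
    have hqc : ContinuousAt (fun ε : ℝ => q (a + ε * Complex.I)) 0 := by
      refine ContinuousAt.div (by fun_prop) (by fun_prop) ?_
      apply pow_ne_zero
      have : ((r ^ 2 - a ^ 2 : ℝ) : ℂ) ≠ 0 := Complex.ofReal_ne_zero.2 hra.ne'
      simpa using this
    exact (hqc.norm.add (Complex.continuous_re.continuousAt.comp hqc)).div_const 2
  have h0 : (‖q (a + (0 : ℝ) * Complex.I)‖ + (q (a + (0 : ℝ) * Complex.I)).re) / 2 = 0 := by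
    have : q (a + (0 : ℝ) * Complex.I) = ((C * a ^ 2 / (r ^ 2 - a ^ 2) ^ (k + 3) : ℝ) : ℂ) := by
      simp [q]
    rw [this, Complex.norm_real, Complex.ofReal_re, Real.norm_eq_abs, abs_of_nonpos]
    · ring
    · exact div_nonpos_of_nonpos_of_nonneg (mul_nonpos_of_nonpos_of_nonneg hC (sq_nonneg _))
        (by positivity)
  have ht := hcont.tendsto
  rw [h0] at ht
  have ht2 := (ht.mono_left (nhdsWithin_le_nhds (s := Set.Ioi 0))).sqrt
  rw [Real.sqrt_zero] at ht2
  rw [tendsto_zero_iff_abs_tendsto_zero]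
  refine ht2.congr' ?_
  filter_upwards [self_mem_nhdsWithin] with ε hε
  have hε : 0 < ε := hε
  rw [← hq _ (by simpa using hε), ← hre, Real.sqrt_sq_eq_abs]
  rfl
end

theorem stmt_2 (n : ℕ) (hn : 2 ≤ n) (hne : Even n)
    (v : EuclideanSpace ℝ (Fin n)) (a : ℝ) (ha : |a| < ‖v‖) :
    Tendsto
      (fun ε : ℝ =>
        (∫ ω in Metric.sphere (0 : EuclideanSpace ℝ (Fin n)) 1,
            (1 : ℂ) / ((⟪ω, v⟫ : ℂ) - a - ε * Complex.I) ^ n ∂μH[n - 1]).re)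
      (nhdsWithin 0 (Set.Ioi 0)) (nhds 0) := by
  obtain ⟨k, rfl⟩ : ∃ k, n = k + 2 := ⟨n - 2, by omega⟩
  have hk : Even k := by
    rw [Nat.even_add] at hne; exact hne.2 even_two
  generalize hd : (((k + 2 : ℕ) : ℝ) - 1) = d
  set μ : Measure (EuclideanSpace ℝ (Fin (k + 2))) := (μH[d]).restrict (Metric.sphere 0 1) with hμ
  have hs : ∀ᵐ x ∂μ, ‖x‖ = 1 := by
    filter_upwards [ae_restrict_mem (μ := μH[d]) (Metric.isClosed_sphere (x := (0 : EuclideanSpace ℝ (Fin (k + 2)))) (ε := 1)).measurableSet] with x hx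
    simpa using hx
  have hinv : ∀ R : EuclideanSpace ℝ (Fin (k + 2)) ≃ₗᵢ[ℝ] EuclideanSpace ℝ (Fin (k + 2)),
      MeasurePreserving R μ μ := by
    intro R
    have h := (R.toIsometryEquiv.measurePreserving_hausdorffMeasure d).restrict_preimage_emb
      R.toHomeomorph.measurableEmbedding (Metric.sphere 0 1)
    have h2 : (R.toIsometryEquiv ⁻¹' (Metric.sphere 0 1)) = Metric.sphere 0 1 := by
      ext x; simp
    rw [h2] at h
    exact h
  have hform : ∀ ε : ℝ, (fun x : EuclideanSpace ℝ (Fin (k + 2)) =>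
      (1 : ℂ) / ((⟪x, v⟫ : ℂ) - a - ε * Complex.I) ^ (k + 2)) =
      fun x => (((⟪x, v⟫ : ℂ) - (a + ε * Complex.I)) ^ (k + 2))⁻¹ := by
    intro ε; ext x; rw [one_div, sub_sub]
  simp only [hform]
  by_cases hfin : IsFiniteMeasure μ
  · have hvpos : 0 < ‖v‖ := (abs_nonneg a).trans_lt ha
    obtain ⟨b, hb⟩ := Orthonormal.exists_orthonormalBasis_extension_of_card_eq (𝕜 := ℝ)
      (E := EuclideanSpace ℝ (Fin (k + 2))) (ι := Fin (k + 2)) (by simp)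
      (v := fun _ => (‖v‖⁻¹ : ℝ) • v) (s := {0}) (by
        constructor
        · intro i; simp [norm_smul, hvpos.ne']
        · intro i j hij; exact absurd (Subsingleton.elim i j) hij)
    have hb0 := hb 0 rfl
    refine re_tendsto k hk b 0 μ hs hinv v ‖v‖ ?_ a ha
    rw [hb0, smul_smul, mul_inv_cancel₀ hvpos.ne', one_smul]
  · refine tendsto_const_nhds.congr' ?_
    filter_upwards [self_mem_nhdsWithin] with ε hε
    have hε : 0 < ε := hε
    rw [integral_undef, Complex.zero_re]
    intro hint
    apply hfin
    have hz : 0 < (a + ε * Complex.I : ℂ).im := by simpa using hε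
    have h1 := hint.bdd_mul (f := fun x => ((⟪x, v⟫ : ℂ) - (a + ε * Complex.I)) ^ (k + 2))
      (c := (‖v‖ + ‖(a + ε * Complex.I : ℂ)‖) ^ (k + 2))
      (Continuous.aestronglyMeasurable (by fun_prop)) (by
        filter_upwards [hs] with x hx
        rw [norm_pow]
        gcongr
        refine (norm_sub_le _ _).trans ?_
        gcongr
        rw [Complex.norm_real]
        have := norm_inner_le_norm (𝕜 := ℝ) x v
        rwa [hx, one_mul] at this)
    have h2 : (fun x : EuclideanSpace ℝ (Fin (k + 2)) =>
        ((⟪x, v⟫ : ℂ) - (a + ε * Complex.I)) ^ (k + 2) *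
        (((⟪x, v⟫ : ℂ) - (a + ε * Complex.I)) ^ (k + 2))⁻¹) = fun _ => (1 : ℂ) := by
      ext x
      exact mul_inv_cancel₀ (pow_ne_zero _ (sub_ne _ _ hz))
    rw [h2] at h1
    exact (integrable_const_iff_isFiniteMeasure one_ne_zero).1 h1
end

section
/- Let v ∈ ℝ^n and a ∈ ℝ with |a| < |v|, and let n ≥ 3 be odd. Then the imaginary part of the limit as ε→0+ of ∫_{S^{n−1}} dω/(⟨ω,v⟩ − a − iε)^n equals zero. -/
open MeasureTheory Filter
open scoped RealInnerProductSpace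

/-- Volume of the ellipsoid with focus at the origin, axis along a coordinate vector. -/
lemma ellipsoid_coord (n m : ℕ) (hm : n + 1 = 2 * m) (i : Fin n)
    (z r : ℝ) (hr : 0 ≤ r) (hz : r < z) :
    volume {x : EuclideanSpace ℝ (Fin n) | z * ‖x‖ - r * x i < 1}
      = ENNReal.ofReal (z / (z ^ 2 - r ^ 2) ^ m) *
        volume (Metric.ball (0 : EuclideanSpace ℝ (Fin n)) 1) := by
  have hz0 : 0 < z := hr.trans_lt hz
  have hD : 0 < z ^ 2 - r ^ 2 := by nlinarith
  set D := z ^ 2 - r ^ 2 with hDdef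
  set q := Real.sqrt D with hq
  have hq0 : 0 < q := Real.sqrt_pos.2 hD
  have hqq : q ^ 2 = D := Real.sq_sqrt hD.le
  let d : Fin n → ℝ := fun j => if j = i then D / z else q
  let A : EuclideanSpace ℝ (Fin n) →ₗ[ℝ] EuclideanSpace ℝ (Fin n) :=
    Matrix.toLin (EuclideanSpace.basisFun (Fin n) ℝ).toBasis
      (EuclideanSpace.basisFun (Fin n) ℝ).toBasis (Matrix.diagonal d)
  have hAx : ∀ x j, A x j = d j * x j := by
    intro x j
    simp only [A, Matrix.toLin_apply]
    simp [Matrix.mulVec_diagonal, Finset.sum_apply, Pi.single_apply]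
  have hdet : LinearMap.det A = D ^ m / z := by
    simp only [A, LinearMap.det_toLin, Matrix.det_diagonal, d]
    rw [Finset.prod_ite]
    have h1 : n - 1 = 2 * (m - 1) := by omega
    have h2 : m = (m - 1) + 1 := by omega
    simp only [Finset.filter_eq', Finset.filter_ne', Finset.mem_univ, if_true, Finset.prod_const,
      Finset.card_singleton, Finset.card_erase_of_mem, Finset.card_univ, Fintype.card_fin, pow_one]
    rw [h1, pow_mul, hqq]
    conv_rhs => rw [h2, pow_succ]
    ring
  have hset : {x : EuclideanSpace ℝ (Fin n) | z * ‖x‖ - r * x i < 1}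
      = (fun x => x + (- EuclideanSpace.single i (r / D))) ⁻¹' (A ⁻¹' Metric.ball 0 1) := by
    ext x
    simp only [Set.mem_ofPred_eq, Set.mem_preimage, mem_ball_zero_iff]
    have h1 : ‖x‖ ^ 2 = x i ^ 2 + ∑ j ∈ Finset.univ.erase i, x j ^ 2 := by
      rw [EuclideanSpace.real_norm_sq_eq, ← Finset.add_sum_erase _ _ (Finset.mem_univ i)]
    have h2 : ‖A (x + (- EuclideanSpace.single i (r / D)))‖ ^ 2
        = (D / z * (x i - r / D)) ^ 2 + D * ∑ j ∈ Finset.univ.erase i, x j ^ 2 := by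
      rw [EuclideanSpace.real_norm_sq_eq, ← Finset.add_sum_erase _ _ (Finset.mem_univ i),
        Finset.mul_sum]
      congr 1
      · rw [hAx]; simp [d, sub_eq_add_neg]
      · refine Finset.sum_congr rfl fun j hj => ?_
        have hj' : j ≠ i := Finset.ne_of_mem_erase hj
        rw [hAx]; simp [d, hj', mul_pow, hqq]
    set S := ∑ j ∈ Finset.univ.erase i, x j ^ 2
    have h3 : z ^ 2 * (‖A (x + (- EuclideanSpace.single i (r / D)))‖ ^ 2 - 1)
        = D * ((z * ‖x‖) ^ 2 - (1 + r * x i) ^ 2) := by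
      rw [h2, mul_pow z, h1]
      field_simp
      rw [hDdef]; ring
    have hxi : |x i| ≤ ‖x‖ := by simpa using PiLp.norm_apply_le x i
    have hxi' := abs_le.1 hxi
    have hx0 := norm_nonneg x
    have hpos : z * ‖x‖ < 1 + r * x i ↔ (z * ‖x‖) ^ 2 < (1 + r * x i) ^ 2 := by
      constructor
      · intro h; exact pow_lt_pow_left₀ h (by positivity) two_ne_zero
      · intro h
        have h4 : z * ‖x‖ < |1 + r * x i| := by
          have := sq_lt_sq.1 h
          rwa [abs_of_nonneg (by positivity)] at this
        rcases abs_cases (1 + r * x i) with h5 | h5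
        · linarith [h5.1]
        · nlinarith [h5.1, mul_le_mul_of_nonneg_left hxi'.1 hr]
    rw [sub_lt_iff_lt_add, hpos, ← sq_lt_one_iff₀ (norm_nonneg _)]
    constructor
    · intro h
      by_contra hc
      push Not at hc
      nlinarith [mul_nonneg (sq_nonneg z) (sub_nonneg.2 hc), mul_pos hD (sub_pos.2 h)]
    · intro h
      by_contra hc
      push Not at hc
      nlinarith [mul_pos (pow_pos hz0 2) (sub_pos.2 h), mul_nonneg hD.le (sub_nonneg.2 hc)]
  rw [hset, measure_preimage_add_right, Measure.addHaar_preimage_linearMap _ (by rw [hdet]; positivity),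
    hdet, inv_div, abs_of_pos (by positivity)]

lemma exists_rot_s3 {n : ℕ} {u w : EuclideanSpace ℝ (Fin n)} (h : ‖u‖ = ‖w‖) :
    ∃ R : EuclideanSpace ℝ (Fin n) ≃ₗᵢ[ℝ] EuclideanSpace ℝ (Fin n), R u = w :=
  ⟨_, Submodule.reflection_sub h⟩

lemma ellipsoid_vol (n m : ℕ) (hm : n + 1 = 2 * m) (hn : 0 < n)
    (w : EuclideanSpace ℝ (Fin n)) (hw : ‖w‖ = 1)
    (z r : ℝ) (hr : 0 ≤ r) (hz : r < z) :
    volume {x : EuclideanSpace ℝ (Fin n) | z * ‖x‖ - r * ⟪w, x⟫ < 1}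
      = ENNReal.ofReal (z / (z ^ 2 - r ^ 2) ^ m) *
        volume (Metric.ball (0 : EuclideanSpace ℝ (Fin n)) 1) := by
  rw [← ellipsoid_coord n m hm ⟨0, hn⟩ z r hr hz]
  obtain ⟨R, hR⟩ := exists_rot_s3 (u := w) (w := EuclideanSpace.single ⟨0, hn⟩ (1:ℝ)) (by simp [hw])
  have hRm : MeasurePreserving (R.toMeasurableEquiv : _ → _) volume volume := R.measurePreserving
  rw [← hRm.measure_preimage_equiv {x : EuclideanSpace ℝ (Fin n) | z * ‖x‖ - r * x ⟨0, hn⟩ < 1}]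
  congr 1
  ext x
  have : ⟪w, x⟫ = (R x) ⟨0, hn⟩ := by
    rw [← R.inner_map_map, hR, EuclideanSpace.inner_single_left]; simp
  simp [this]

lemma lint_rot {n : ℕ} (μ : Measure (EuclideanSpace ℝ (Fin n)))
    (hμ : ∀ R : EuclideanSpace ℝ (Fin n) ≃ₗᵢ[ℝ] EuclideanSpace ℝ (Fin n), MeasurePreserving R μ μ)
    (h : ℝ → ENNReal) (u w : EuclideanSpace ℝ (Fin n)) (huw : ‖u‖ = ‖w‖) :
    ∫⁻ ω, h ⟪ω, u⟫ ∂μ = ∫⁻ ω, h ⟪ω, w⟫ ∂μ := by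
  obtain ⟨R, hR⟩ := exists_rot_s3 huw
  rw [← (hμ R).lintegral_comp_emb R.toMeasurableEquiv.measurableEmbedding (fun ω => h ⟪ω, w⟫)]
  simp [← hR, R.inner_map_map]

lemma real_formula_lint (n m : ℕ) (hm : n + 1 = 2 * m) (hn : 0 < n)
    (μ : Measure (EuclideanSpace ℝ (Fin n))) [IsFiniteMeasure μ]
    (hμ : ∀ R : EuclideanSpace ℝ (Fin n) ≃ₗᵢ[ℝ] EuclideanSpace ℝ (Fin n), MeasurePreserving R μ μ)
    (hS : ∀ᵐ ω ∂μ, ‖ω‖ = 1) (v : EuclideanSpace ℝ (Fin n)) (z : ℝ) (hz : ‖v‖ < z) :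
    ∫⁻ ω, ENNReal.ofReal (1 / (z - ⟪ω, v⟫) ^ n) ∂μ
      = ENNReal.ofReal (z / (z ^ 2 - ‖v‖ ^ 2) ^ m) * μ Set.univ := by
  set B := volume (Metric.ball (0 : EuclideanSpace ℝ (Fin n)) 1) with hB
  have hB0 : B ≠ 0 := (Metric.measure_ball_pos _ _ one_pos).ne'
  have hBt : B ≠ ⊤ := measure_ball_lt_top.ne
  have e1 : ∫⁻ ω, (∫⁻ x : EuclideanSpace ℝ (Fin n),
        (Set.Iio (1:ℝ)).indicator 1 (z * ‖x‖ - ⟪ω, ‖x‖ • v⟫)) ∂μ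
      = (∫⁻ ω, ENNReal.ofReal (1 / (z - ⟪ω, v⟫) ^ n) ∂μ) * B := by
    rw [← lintegral_mul_const' _ _ hBt]
    refine lintegral_congr_ae ?_
    filter_upwards [hS] with ω hω
    have hpos : 0 < z - ⟪ω, v⟫ := by
      have := real_inner_le_norm ω v
      rw [hω] at this; linarith
    have : (fun x : EuclideanSpace ℝ (Fin n) =>
        (Set.Iio (1:ℝ)).indicator (1 : ℝ → ENNReal) (z * ‖x‖ - ⟪ω, ‖x‖ • v⟫))
        = (Metric.ball (0 : EuclideanSpace ℝ (Fin n)) (1 / (z - ⟪ω, v⟫))).indicator 1 := by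
      ext x
      have : z * ‖x‖ - ⟪ω, ‖x‖ • v⟫ < 1 ↔ ‖x‖ < 1 / (z - ⟪ω, v⟫) := by
        rw [lt_div_iff₀ hpos, inner_smul_right]; ring_nf
      rw [one_div] at this
      simp [Set.indicator, this]
    rw [this, lintegral_indicator_one measurableSet_ball,
      Measure.addHaar_ball_of_pos _ _ (by positivity)]
    simp [hB]
  have e2 : ∫⁻ ω, (∫⁻ x : EuclideanSpace ℝ (Fin n),
        (Set.Iio (1:ℝ)).indicator 1 (z * ‖x‖ - ⟪ω, ‖x‖ • v⟫)) ∂μ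
      = ∫⁻ ω, (∫⁻ x : EuclideanSpace ℝ (Fin n),
        (Set.Iio (1:ℝ)).indicator 1 (z * ‖x‖ - ⟪ω, ‖v‖ • x⟫)) ∂μ := by
    have hm1 : Measurable ((Set.Iio (1:ℝ)).indicator (1 : ℝ → ENNReal)) :=
      measurable_one.indicator measurableSet_Iio
    rw [lintegral_lintegral_swap]
    · refine Eq.trans ?_ (lintegral_lintegral_swap ?_)
      rotate_left
      · refine (hm1.comp (Continuous.measurable ?_)).aemeasurable
        fun_prop
      refine lintegral_congr fun x => ?_
      exact lint_rot μ hμ (fun t => (Set.Iio (1:ℝ)).indicator 1 (z * ‖x‖ - t))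
        (‖x‖ • v) (‖v‖ • x)
        (by simp [norm_smul, mul_comm])
    · refine (hm1.comp (Continuous.measurable ?_)).aemeasurable
      fun_prop
  have e3 : ∫⁻ ω, (∫⁻ x : EuclideanSpace ℝ (Fin n),
        (Set.Iio (1:ℝ)).indicator 1 (z * ‖x‖ - ⟪ω, ‖v‖ • x⟫)) ∂μ
      = (ENNReal.ofReal (z / (z ^ 2 - ‖v‖ ^ 2) ^ m) * μ Set.univ) * B := by
    have : ∀ᵐ ω ∂μ, (∫⁻ x : EuclideanSpace ℝ (Fin n),
        (Set.Iio (1:ℝ)).indicator 1 (z * ‖x‖ - ⟪ω, ‖v‖ • x⟫))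
        = ENNReal.ofReal (z / (z ^ 2 - ‖v‖ ^ 2) ^ m) * B := by
      filter_upwards [hS] with ω hω
      rw [hB, ← ellipsoid_vol n m hm hn ω hω z ‖v‖ (norm_nonneg _) hz, ← lintegral_indicator_one]
      · refine lintegral_congr fun x => ?_
        simp [Set.indicator, inner_smul_right]
      · exact (isOpen_lt (by fun_prop) (by fun_prop)).measurableSet
    rw [lintegral_congr_ae this, lintegral_const]
    ring
  exact (ENNReal.mul_left_inj hB0 hBt).1 (by rw [← e1, e2, e3])

lemma slit_lower {r : ℝ} {z₀ : ℂ} (hz : z₀ - r ∈ Complex.slitPlane) :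
    ∃ δ > 0, ∀ t : ℝ, t ≤ r → δ ≤ ‖z₀ - t‖ := by
  rcases Complex.mem_slitPlane_iff.1 hz with h | h
  · refine ⟨_, h, fun t ht => ?_⟩
    refine le_trans ?_ (Complex.re_le_norm _)
    simp; linarith
  · refine ⟨_, abs_pos.2 h, fun t ht => ?_⟩
    refine le_trans ?_ (Complex.abs_im_le_norm _)
    simp

lemma G_diff (n : ℕ) 
    (μ : Measure (EuclideanSpace ℝ (Fin n))) [IsFiniteMeasure μ]
    (hS : ∀ᵐ ω ∂μ, ‖ω‖ = 1) (v : EuclideanSpace ℝ (Fin n)) (z₀ : ℂ)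
    (hz : z₀ - (‖v‖ : ℝ) ∈ Complex.slitPlane) :
    DifferentiableAt ℂ (fun z : ℂ => ∫ ω, 1 / (z - (⟪ω, v⟫ : ℝ)) ^ n ∂μ) z₀ := by
  obtain ⟨δ, hδ, hδt⟩ := slit_lower hz
  have hle : ∀ᵐ ω ∂μ, ⟪ω, v⟫ ≤ ‖v‖ := by
    filter_upwards [hS] with ω hω
    have := real_inner_le_norm ω v
    rwa [hω, one_mul] at this
  have hlow : ∀ᵐ ω ∂μ, ∀ z ∈ Metric.ball z₀ (δ / 2), δ / 2 ≤ ‖z - (⟪ω, v⟫ : ℝ)‖ := by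
    filter_upwards [hle] with ω hω z hz'
    have h1 := hδt _ hω
    have h2 : ‖z₀ - (⟪ω, v⟫ : ℝ)‖ ≤ ‖z₀ - z‖ + ‖z - (⟪ω, v⟫ : ℝ)‖ := by
      simpa using norm_add_le (z₀ - z) (z - (⟪ω, v⟫ : ℝ))
    rw [Metric.mem_ball, dist_comm, dist_eq_norm] at hz'
    linarith
  have hmeas : ∀ (z : ℂ), Measurable fun ω : EuclideanSpace ℝ (Fin n) => z - ((⟪ω, v⟫ : ℝ) : ℂ) :=
    fun z => Continuous.measurable (by fun_prop)
  have := hasDerivAt_integral_of_dominated_loc_of_deriv_le (μ := μ) (𝕜 := ℂ)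
    (F := fun z ω => 1 / (z - ((⟪ω, v⟫ : ℝ) : ℂ)) ^ n) (x₀ := z₀)
    (F' := fun z ω => -(n * (z - ((⟪ω, v⟫ : ℝ) : ℂ)) ^ (n - 1)) / ((z - ((⟪ω, v⟫ : ℝ) : ℂ)) ^ n) ^ 2)
    (bound := fun _ => n * (1 / (δ / 2)) ^ (n + 1))
    (s := Metric.ball z₀ (δ / 2)) (Metric.ball_mem_nhds _ (by positivity))
    (Eventually.of_forall fun z => ((measurable_const.div ((hmeas z).pow_const n))).aestronglyMeasurable)
    ?_ ?_ ?_ (integrable_const _) ?_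
  · exact this.2.differentiableAt
  · refine Integrable.of_bound ((measurable_const.div ((hmeas z₀).pow_const n))).aestronglyMeasurable
      ((1 / (δ / 2)) ^ n) ?_
    filter_upwards [hlow] with ω hω
    have := hω z₀ (Metric.mem_ball_self (by positivity))
    rw [norm_div, norm_pow, norm_one, one_div_pow]
    gcongr
  · refine Measurable.aestronglyMeasurable ?_
    have := hmeas z₀
    fun_prop
  · filter_upwards [hlow] with ω hω z hz'
    have h := hω z hz'
    have hne : 0 < ‖z - ((⟪ω, v⟫ : ℝ) : ℂ)‖ := lt_of_lt_of_le (by positivity) h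
    rcases n with _ | k
    · simp
    · rw [norm_div, norm_neg, norm_mul, norm_pow, norm_pow, norm_pow, Complex.norm_natCast]
      set y := ‖z - ((⟪ω, v⟫ : ℝ) : ℂ)‖
      have : (((k + 1 : ℕ) : ℝ) * y ^ (k + 1 - 1)) / (y ^ (k + 1)) ^ 2
          = ((k + 1 : ℕ) : ℝ) * (1 / y) ^ (k + 1 + 1) := by
        simp only [Nat.add_sub_cancel, one_div, inv_pow]
        field_simp
        ring
      rw [this]
      gcongr
  · filter_upwards [hlow] with ω hω z hz'
    have h := hω z hz'
    have hne : (z - ((⟪ω, v⟫ : ℝ) : ℂ)) ≠ 0 := norm_pos_iff.1 (lt_of_lt_of_le (by positivity) h)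
    have h1 : HasDerivAt (fun z : ℂ => (z - ((⟪ω, v⟫ : ℝ) : ℂ)) ^ n)
        (n * (z - ((⟪ω, v⟫ : ℝ) : ℂ)) ^ (n - 1)) z := by
      have := ((hasDerivAt_id z).sub_const ((⟪ω, v⟫ : ℝ) : ℂ)).pow n
      simp only [id, mul_one] at this
      exact this
    simp only [one_div]
    exact h1.inv (pow_ne_zero n hne)

lemma slit_preconn (r : ℝ) : IsPreconnected {z : ℂ | z - r ∈ Complex.slitPlane} := by
  have h : IsPreconnected Complex.slitPlane :=
    (Complex.starConvex_one_slitPlane.isPathConnected Complex.one_mem_slitPlane).isConnected.isPreconnected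
  convert h.image (fun z => z + r) (by fun_prop) using 1
  ext z
  simp [sub_eq_add_neg]

lemma real_formula (n m : ℕ) (hm : n + 1 = 2 * m) (hn : 0 < n)
    (μ : Measure (EuclideanSpace ℝ (Fin n))) [IsFiniteMeasure μ]
    (hμ : ∀ R : EuclideanSpace ℝ (Fin n) ≃ₗᵢ[ℝ] EuclideanSpace ℝ (Fin n), MeasurePreserving R μ μ)
    (hS : ∀ᵐ ω ∂μ, ‖ω‖ = 1) (v : EuclideanSpace ℝ (Fin n)) (z : ℝ) (hz : ‖v‖ < z) :
    ∫ ω, 1 / ((z : ℂ) - (⟪ω, v⟫ : ℝ)) ^ n ∂μ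
      = (z : ℂ) / ((z : ℂ) ^ 2 - (‖v‖ : ℝ) ^ 2) ^ m * (μ.real Set.univ : ℝ) := by
  have hz0 : 0 < z := (norm_nonneg v).trans_lt hz
  have hD : 0 < z ^ 2 - ‖v‖ ^ 2 := by nlinarith [norm_nonneg v]
  have h1 : ∫ ω, 1 / (z - ⟪ω, v⟫) ^ n ∂μ = z / (z ^ 2 - ‖v‖ ^ 2) ^ m * μ.real Set.univ := by
    rw [integral_eq_lintegral_of_nonneg_ae, real_formula_lint n m hm hn μ hμ hS v z hz,
      ENNReal.toReal_mul, ENNReal.toReal_ofReal (by positivity)]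
    · rfl
    · filter_upwards [hS] with ω hω
      have := real_inner_le_norm ω v
      rw [hω] at this
      have : 0 < z - ⟪ω, v⟫ := by linarith
      simp only [Pi.zero_apply]
      positivity
    · refine Measurable.aestronglyMeasurable ?_
      have : Measurable fun ω : EuclideanSpace ℝ (Fin n) => z - ⟪ω, v⟫ :=
        Continuous.measurable (by fun_prop)
      fun_prop
  have h2 := congrArg (fun x : ℝ => (x : ℂ)) h1
  simp only [← integral_complex_ofReal] at h2
  push_cast at h2
  exact h2

lemma complex_formula (n m : ℕ) (hm : n + 1 = 2 * m) (hn : 0 < n)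
    (μ : Measure (EuclideanSpace ℝ (Fin n))) [IsFiniteMeasure μ]
    (hμ : ∀ R : EuclideanSpace ℝ (Fin n) ≃ₗᵢ[ℝ] EuclideanSpace ℝ (Fin n), MeasurePreserving R μ μ)
    (hS : ∀ᵐ ω ∂μ, ‖ω‖ = 1) (v : EuclideanSpace ℝ (Fin n)) (z : ℂ)
    (hz : z - (‖v‖ : ℝ) ∈ Complex.slitPlane) :
    ∫ ω, 1 / (z - (⟪ω, v⟫ : ℝ)) ^ n ∂μ
      = z / (z ^ 2 - (‖v‖ : ℝ) ^ 2) ^ m * (μ.real Set.univ : ℝ) := by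
  have hopen : IsOpen {z : ℂ | z - (‖v‖ : ℝ) ∈ Complex.slitPlane} :=
    Complex.isOpen_slitPlane.preimage (by fun_prop)
  have hG : AnalyticOnNhd ℂ (fun z : ℂ => ∫ ω, 1 / (z - (⟪ω, v⟫ : ℝ)) ^ n ∂μ)
      {z : ℂ | z - (‖v‖ : ℝ) ∈ Complex.slitPlane} :=
    DifferentiableOn.analyticOnNhd
      (fun w hw => (G_diff n μ hS v w hw).differentiableWithinAt) hopen
  have hH : AnalyticOnNhd ℂ
      (fun z : ℂ => z / (z ^ 2 - (‖v‖ : ℝ) ^ 2) ^ m * (μ.real Set.univ : ℝ))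
      {z : ℂ | z - (‖v‖ : ℝ) ∈ Complex.slitPlane} := by
    refine DifferentiableOn.analyticOnNhd (fun w hw => ?_) hopen
    have hne : w ^ 2 - ((‖v‖ : ℝ) : ℂ) ^ 2 ≠ 0 := by
      obtain ⟨δ, hδ, h⟩ := slit_lower hw
      have h1 := h ‖v‖ le_rfl
      have h2 := h (-‖v‖) (by linarith [norm_nonneg v])
      have h1' : w - ((‖v‖ : ℝ) : ℂ) ≠ 0 := norm_pos_iff.1 (hδ.trans_le h1)
      have h2' : w - ((-‖v‖ : ℝ) : ℂ) ≠ 0 := norm_pos_iff.1 (hδ.trans_le h2)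
      have : w ^ 2 - ((‖v‖ : ℝ) : ℂ) ^ 2
        = (w - ((‖v‖ : ℝ) : ℂ)) * (w - ((-‖v‖ : ℝ) : ℂ)) := by push_cast; ring
      rw [this]; exact mul_ne_zero h1' h2'
    have := pow_ne_zero m hne
    refine DifferentiableAt.differentiableWithinAt ?_
    fun_prop (disch := assumption)
  refine hG.eqOn_of_preconnected_of_frequently_eq hH (slit_preconn ‖v‖)
    (z₀ := ((‖v‖ + 1 : ℝ) : ℂ)) (by simp [Complex.mem_slitPlane_iff]) ?_ hz
  have ht : Tendsto (fun x : ℝ => (x : ℂ)) (nhdsWithin (‖v‖ + 1) {‖v‖ + 1}ᶜ)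
      (nhdsWithin ((‖v‖ + 1 : ℝ) : ℂ) {((‖v‖ + 1 : ℝ) : ℂ)}ᶜ) := by
    refine tendsto_nhdsWithin_iff.2 ⟨?_, ?_⟩
    · exact (Complex.continuous_ofReal.tendsto _).mono_left nhdsWithin_le_nhds
    · filter_upwards [self_mem_nhdsWithin] with x hx
      simpa only [Set.mem_compl_iff, Set.mem_singleton_iff, Complex.ofReal_inj] using hx
  refine ht.frequently (Eventually.frequently ?_)
  filter_upwards [nhdsWithin_le_nhds (lt_mem_nhds (lt_add_one ‖v‖))] with x hx
  exact real_formula n m hm hn μ hμ hS v x hx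

lemma hausdorff_rot {n : ℕ} (d : ℝ)
    (R : EuclideanSpace ℝ (Fin n) ≃ₗᵢ[ℝ] EuclideanSpace ℝ (Fin n)) :
    MeasurePreserving R (μH[d].restrict (Metric.sphere (0 : EuclideanSpace ℝ (Fin n)) 1))
      (μH[d].restrict (Metric.sphere (0 : EuclideanSpace ℝ (Fin n)) 1)) := by
  have h := (R.toIsometryEquiv.measurePreserving_hausdorffMeasure d).restrict_preimage
    (s := Metric.sphere (0 : EuclideanSpace ℝ (Fin n)) 1) Metric.isClosed_sphere.measurableSet
  have e : R.toIsometryEquiv ⁻¹' (Metric.sphere (0 : EuclideanSpace ℝ (Fin n)) 1)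
      = Metric.sphere (0 : EuclideanSpace ℝ (Fin n)) 1 := by
    ext x; simp
  rw [e] at h
  exact h

theorem stmt_3 (n : ℕ) (hn : 3 ≤ n) (hodd : Odd n)
    (v : EuclideanSpace ℝ (Fin n)) (a : ℝ) (ha : |a| < ‖v‖) :
    Tendsto
      (fun ε : ℝ =>
        (∫ ω in Metric.sphere (0 : EuclideanSpace ℝ (Fin n)) 1,
            (1 : ℂ) / ((⟪ω, v⟫ : ℂ) - a - ε * Complex.I) ^ n ∂μH[n - 1]).im)
      (nhdsWithin 0 (Set.Ioi 0)) (nhds 0) := by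
  obtain ⟨k, hk⟩ := hodd
  have hm : n + 1 = 2 * (k + 1) := by omega
  set μ : Measure (EuclideanSpace ℝ (Fin n)) :=
    μH[n - 1].restrict (Metric.sphere (0 : EuclideanSpace ℝ (Fin n)) 1) with hμdef
  have hS : ∀ᵐ ω ∂μ, ‖ω‖ = 1 := by
    filter_upwards [ae_restrict_mem Metric.isClosed_sphere.measurableSet] with ω hω
    simpa using hω
  by_cases hfin : IsFiniteMeasure μ
  · have hD : (a : ℂ) ^ 2 - ((‖v‖ : ℝ) : ℂ) ^ 2 ≠ 0 := by
      have : a ^ 2 - ‖v‖ ^ 2 ≠ 0 := by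
        have := sq_lt_sq.2 (ha.trans_le (le_abs_self _))
        linarith
      exact_mod_cast this
    have key : ∀ ε : ℝ, 0 < ε →
        ∫ ω, (1 : ℂ) / (((⟪ω, v⟫ : ℝ) : ℂ) - a - ε * Complex.I) ^ n ∂μ
        = -(((a : ℂ) + ε * Complex.I) / (((a : ℂ) + ε * Complex.I) ^ 2 - (‖v‖ : ℝ) ^ 2) ^ (k + 1)
          * (μ.real Set.univ : ℝ)) := by
      intro ε hε
      rw [← complex_formula n (k + 1) hm (by omega) μ (fun R => hausdorff_rot _ R) hS v _
        (by simp [Complex.mem_slitPlane_iff, hε.ne']), ← integral_neg]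
      congr 1
      ext ω
      have : ((⟪ω, v⟫ : ℝ) : ℂ) - a - ε * Complex.I
        = -((a : ℂ) + ε * Complex.I - ((⟪ω, v⟫ : ℝ) : ℂ)) := by ring
      rw [this, Odd.neg_pow ⟨k, hk⟩, div_neg]
    have hlim : Tendsto (fun ε : ℝ => (-(((a : ℂ) + ε * Complex.I) /
          (((a : ℂ) + ε * Complex.I) ^ 2 - (‖v‖ : ℝ) ^ 2) ^ (k + 1)
          * (μ.real Set.univ : ℝ))).im) (nhds 0) (nhds 0) := by
      have hc : ContinuousAt (fun ε : ℝ => (-(((a : ℂ) + ε * Complex.I) /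
          (((a : ℂ) + ε * Complex.I) ^ 2 - (‖v‖ : ℝ) ^ 2) ^ (k + 1)
          * (μ.real Set.univ : ℝ))).im) 0 := by
        refine Complex.continuous_im.continuousAt.comp ?_
        refine ((ContinuousAt.div (by fun_prop) (by fun_prop) ?_).mul continuousAt_const).neg
        simpa using fun h => absurd h hD
      have h0 : (-(((a : ℂ) + (0 : ℝ) * Complex.I) /
          (((a : ℂ) + (0 : ℝ) * Complex.I) ^ 2 - (‖v‖ : ℝ) ^ 2) ^ (k + 1)
          * (μ.real Set.univ : ℝ))).im = 0 := by
        have : (-(((a : ℂ) + (0 : ℝ) * Complex.I) /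
          (((a : ℂ) + (0 : ℝ) * Complex.I) ^ 2 - (‖v‖ : ℝ) ^ 2) ^ (k + 1)
          * (μ.real Set.univ : ℝ)))
          = ((-(a / (a ^ 2 - ‖v‖ ^ 2) ^ (k + 1) * μ.real Set.univ) : ℝ) : ℂ) := by
          push_cast; simp
        rw [this, Complex.ofReal_im]
      have := hc.tendsto
      rwa [h0] at this
    refine (hlim.mono_left nhdsWithin_le_nhds).congr' ?_
    filter_upwards [self_mem_nhdsWithin] with ε hε
    rw [← key ε hε]
  · refine tendsto_const_nhds.congr' ?_
    filter_upwards [self_mem_nhdsWithin] with ε hε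
    rw [Set.mem_Ioi] at hε
    rw [integral_undef, Complex.zero_im]
    intro hInt
    apply hfin
    have hb : Integrable (fun _ : EuclideanSpace ℝ (Fin n) =>
        1 / (‖v‖ + |a| + ε) ^ n) μ := by
      refine hInt.mono aestronglyMeasurable_const ?_
      filter_upwards [hS] with ω hω
      have h1 : ‖((⟪ω, v⟫ : ℝ) : ℂ) - a - ε * Complex.I‖ ≤ ‖v‖ + |a| + ε := by
        have h3 : |⟪ω, v⟫| ≤ ‖v‖ := by
          have := abs_real_inner_le_norm ω v
          rwa [hω, one_mul] at this
        refine (norm_sub_le _ _).trans (add_le_add ((norm_sub_le _ _).trans (add_le_add ?_ ?_)) ?_)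
        · simpa using h3
        · simp
        · simp [abs_of_pos hε]
      have h2 : ((⟪ω, v⟫ : ℝ) : ℂ) - a - ε * Complex.I ≠ 0 := by
        intro h
        have := congrArg Complex.im h
        simp at this
        exact hε.ne' this
      have h2' := norm_pos_iff.2 h2
      rw [Real.norm_of_nonneg (by positivity), norm_div, norm_one, norm_pow]
      gcongr
    rw [integrable_const_iff] at hb
    rcases hb with hb | hb
    · have : 0 < 1 / (‖v‖ + |a| + ε) ^ n := by positivity
      exact absurd hb this.ne'
    · exact hb
end
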